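/- Let N be a nonempty compact metric space, K a Hausdorff topological space, f : N → N a continuous injective map, p : N → K a continuous surjection, and g : K → K a continuous map with p ∘ f = g ∘ p. Assume the following uniform contracting condition on fibres: for every ε > 0 there exists m such that for every k ∈ K the set f^m(p⁻¹(k)) has diameter less than ε. Let Λ = ⋂_{m ≥ 0} f^m(N), let Σ = { a : ℕ → K | for all m, a(m) = g(a(m+1)) } with the topology induced from the product K^ℕ, and let h : Σ → Σ be the shift (h a)(0) = g(a(0)), (h a)(m+1) = a(m). Then there exists a homeomorphism P : Λ → Σ such that P(f(x)) = h(P(x)) for all x ∈ Λ; that is, (Λ, f|_Λ) and (Σ, h) are topologically conjugate. -/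

import Mathlib

/-- The inverse limit of the sequence `K ← K ← K ← ⋯` along `g`, realized as a subspace of
the product space `K^ℕ`. -/
def invLimit {K : Type*} [TopologicalSpace K] (g : K → K) : Set (ℕ → K) :=
  {a : ℕ → K | ∀ m, a m = g (a (m + 1))}

/-- The underlying function of the shift map: `(a₀, a₁, a₂, …) ↦ (g a₀, a₀, a₁, …)`. -/
def shiftFun {K : Type*} (g : K → K) (a : ℕ → K) : ℕ → K
  | 0 => g (a 0)
  | (m + 1) => a m

/-- Let `N` be a nonempty compact metric space, `K` a Hausdorff space, `f : N → N`
continuous and injective, `p : N → K` a continuous surjection, and `g : K → K` continuous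
with `p ∘ f = g ∘ p`.  Assume the uniform contracting condition on fibres: for every
`ε > 0` there is an `m` such that every set `f^m(p⁻¹(k))` has diameter `< ε`.  Then the
geometric solenoid `Λ = ⋂_{m ≥ 0} f^m(N)` with the map `f|_Λ` is topologically conjugate to
the inverse-limit solenoid `(Σ, h)`, where `Σ` is the inverse limit of `K ← K ← ⋯` along
`g` and `h` is the shift `h(a₀, a₁, …) = (g a₀, a₀, a₁, …)`. -/
theorem solenoid_conjugate_to_inverse_limit {N K : Type*} [MetricSpace N] [CompactSpace N]
    [Nonempty N] [TopologicalSpace K] [T2Space K]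
    (f : N → N) (hf : Continuous f) (hinj : Function.Injective f)
    (p : N → K) (hp : Continuous p) (hsurj : Function.Surjective p)
    (g : K → K) (hg : Continuous g) (hcomm : p ∘ f = g ∘ p)
    (hcontr : ∀ ε > (0 : ℝ), ∃ m : ℕ, ∀ k : K,
      Metric.diam (f^[m] '' (p ⁻¹' {k})) < ε)
    (Λ : Set N) (hΛ : Λ = ⋂ m : ℕ, Set.range (f^[m])) :
    ∃ P : Λ ≃ₜ invLimit g,
      ∀ (x : N) (hx : x ∈ Λ) (hfx : f x ∈ Λ),
        ((P ⟨f x, hfx⟩ : ℕ → K)) = shiftFun g ((P ⟨x, hx⟩ : ℕ → K)) := by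
  have hmem : ∀ x : Λ, ∀ m : ℕ, ∃ y, f^[m] y = x.1 := by
    intro x m
    have h := hΛ.subset x.2
    exact Set.mem_iInter.1 h m
  have hclosed : IsClosed Λ := by
    rw [hΛ]
    exact isClosed_iInter fun m => (isCompact_range (hf.iterate m)).isClosed
  have : CompactSpace Λ := isCompact_iff_compactSpace.1 hclosed.isCompact
  choose Y hY using hmem
  have hpf : ∀ z, p (f z) = g (p z) := fun z => congrFun hcomm z
  have hYsucc : ∀ x m, f (Y x (m + 1)) = Y x m := by
    intro x m
    apply hinj.iterate m
    rw [hY, ← Function.iterate_succ_apply, hY]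
  have hYcont : ∀ m, Continuous fun x => Y x m := by
    intro m
    have he := ((hf.iterate m).isClosedEmbedding (hinj.iterate m)).isInducing
    rw [he.continuous_iff]
    have : (f^[m] ∘ fun x => Y x m) = Subtype.val := funext fun x => hY x m
    rw [this]
    exact continuous_subtype_val
  let F : Λ → invLimit g := fun x => ⟨fun m => p (Y x m), fun m => by
    rw [← hpf, hYsucc]⟩
  have hFcont : Continuous F :=
    Continuous.subtype_mk (continuous_pi fun m => hp.comp (hYcont m)) _
  have hFinj : Function.Injective F := by
    intro x x' h
    have hm : ∀ m, p (Y x m) = p (Y x' m) := fun m => congrFun (congrArg Subtype.val h) m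
    apply Subtype.ext
    apply eq_of_forall_dist_le
    intro ε hε
    obtain ⟨m, hm'⟩ := hcontr ε hε
    refine le_trans ?_ (hm' (p (Y x' m))).le
    apply Metric.dist_le_diam_of_mem (Metric.isBounded_of_compactSpace)
    · exact ⟨Y x m, hm m, hY x m⟩
    · exact ⟨Y x' m, rfl, hY x' m⟩
  have hFsurj : Function.Surjective F := by
    rintro ⟨a, ha⟩
    have hK : ∀ m, IsCompact (f^[m] '' (p ⁻¹' {a m})) := fun m =>
      ((isClosed_singleton.preimage hp).isCompact).image (hf.iterate m)
    obtain ⟨x, hx⟩ := IsCompact.nonempty_iInter_of_sequence_nonempty_isCompact_isClosed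
      (fun m => f^[m] '' (p ⁻¹' {a m}))
      (by
        rintro m _ ⟨z, hz, rfl⟩
        refine ⟨f z, ?_, rfl⟩
        have hz' : p z = a (m + 1) := hz
        show p (f z) = a m
        rw [hpf, hz', ← ha m])
      (fun m => by
        obtain ⟨z, hz⟩ := hsurj (a m)
        exact ⟨_, z, hz, rfl⟩)
      (hK 0) (fun m => (hK m).isClosed)
    have hx' := Set.mem_iInter.1 hx
    have hxΛ : x ∈ Λ := by
      rw [hΛ]
      refine Set.mem_iInter.2 fun m => ?_
      obtain ⟨z, _, hz⟩ := hx' m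
      exact ⟨z, hz⟩
    refine ⟨⟨x, hxΛ⟩, Subtype.ext (funext fun m => ?_)⟩
    obtain ⟨z, hz, hzx⟩ := hx' m
    have : Y ⟨x, hxΛ⟩ m = z := by
      apply hinj.iterate m
      rw [hY, hzx]
    show p (Y ⟨x, hxΛ⟩ m) = a m
    rw [this]
    exact hz
  refine ⟨Continuous.homeoOfEquivCompactToT2 (f := Equiv.ofBijective F ⟨hFinj, hFsurj⟩) hFcont, ?_⟩
  intro x hx hfx
  show (fun m => p (Y ⟨f x, hfx⟩ m)) = shiftFun g (fun m => p (Y ⟨x, hx⟩ m))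
  funext m
  cases m with
  | zero =>
    have h0 : Y ⟨f x, hfx⟩ 0 = f x := hY ⟨f x, hfx⟩ 0
    have h1 : Y ⟨x, hx⟩ 0 = x := hY ⟨x, hx⟩ 0
    simp only [shiftFun, h0, h1, hpf]
  | succ m =>
    have : Y ⟨f x, hfx⟩ (m + 1) = Y ⟨x, hx⟩ m := by
      apply hinj.iterate (m + 1)
      rw [hY, Function.iterate_succ_apply', hY]
    simp only [shiftFun, this]
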